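/- If a quasivariety K is passively structurally complete, then K has the joint embedding property, and moreover every subquasivariety of K has the joint embedding property. -/

import Mathlib

universe u

open FirstOrder Language Structure

namespace Paper

variable {L : FirstOrder.Language.{u, u}}

/-- Existential positive sentences/formulas: built from atomic formulas by
conjunction, disjunction and existential quantification. -/
inductive IsEP : {n : ℕ} → L.BoundedFormula Empty n → Prop
  | equal {n} (t₁ t₂ : L.Term (Empty ⊕ Fin n)) : IsEP (t₁.bdEqual t₂)
  | rel {n k} (R : L.Relations k) (ts : Fin k → L.Term (Empty ⊕ Fin n)) :
      IsEP (BoundedFormula.rel R ts)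
  | sup {n} {φ ψ : L.BoundedFormula Empty n} : IsEP φ → IsEP ψ → IsEP (φ ⊔ ψ)
  | inf {n} {φ ψ : L.BoundedFormula Empty n} : IsEP φ → IsEP ψ → IsEP (φ ⊓ ψ)
  | ex {n} {φ : L.BoundedFormula Empty (n + 1)} : IsEP φ → IsEP φ.ex

/-- The direct-product structure on a product of structures. -/
def piStructure {ι : Type u} (M : ι → Type u) [∀ i, L.Structure (M i)] :
    L.Structure (∀ i, M i) where
  funMap f x i := funMap f fun j => x j i
  RelMap r x := ∀ i, RelMap r fun j => x j i

/-- An (abstract) class of `L`-structures with universes in `Type u`. -/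
def StructClass (L : FirstOrder.Language.{u, u}) : Type (u + 1) :=
  ∀ M : Type u, L.Structure M → Prop

def SubClass (K₁ K₂ : StructClass L) : Prop :=
  ∀ (M : Type u) (iM : L.Structure M), K₁ M iM → K₂ M iM

def EqClass (K₁ K₂ : StructClass L) : Prop :=
  ∀ (M : Type u) (iM : L.Structure M), K₁ M iM ↔ K₂ M iM

/-- A quasivariety: a class of structures closed under isomorphisms,
substructures, direct products and ultraproducts. -/
structure IsQuasivariety (K : StructClass L) : Prop where
  iso_closed : ∀ (M : Type u) [iM : L.Structure M] (N : Type u) [iN : L.Structure N],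
      Nonempty (M ≃[L] N) → K M iM → K N iN
  sub_closed : ∀ (M : Type u) [iM : L.Structure M] (N : Type u) [iN : L.Structure N],
      Nonempty (M ↪[L] N) → K N iN → K M iM
  prod_closed : ∀ (ι : Type u) (M : ι → Type u) [iM : ∀ i, L.Structure (M i)],
      (∀ i, K (M i) (iM i)) → K (∀ i, M i) (piStructure M)
  ultra_closed : ∀ (ι : Type u) (M : ι → Type u) [iM : ∀ i, L.Structure (M i)]
      (uf : Ultrafilter ι), (∀ i, K (M i) (iM i)) →
      K ((uf : Filter ι).Product M) inferInstance

/-- A variety: a class of structures closed under isomorphisms, homomorphic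
images, substructures and direct products. -/
structure IsVariety (K : StructClass L) : Prop where
  iso_closed : ∀ (M : Type u) [iM : L.Structure M] (N : Type u) [iN : L.Structure N],
      Nonempty (M ≃[L] N) → K M iM → K N iN
  hom_closed : ∀ (M : Type u) [iM : L.Structure M] (N : Type u) [iN : L.Structure N],
      (∃ h : M →[L] N, Function.Surjective h) → K M iM → K N iN
  sub_closed : ∀ (M : Type u) [iM : L.Structure M] (N : Type u) [iN : L.Structure N],
      Nonempty (M ↪[L] N) → K N iN → K M iM
  prod_closed : ∀ (ι : Type u) (M : ι → Type u) [iM : ∀ i, L.Structure (M i)],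
      (∀ i, K (M i) (iM i)) → K (∀ i, M i) (piStructure M)

/-- The quasivariety generated by a class. -/
def QGen (C : StructClass L) : StructClass L :=
  fun M iM => ∀ K : StructClass L, IsQuasivariety K → SubClass C K → K M iM

/-- The variety generated by a class. -/
def VGen (C : StructClass L) : StructClass L :=
  fun M iM => ∀ K : StructClass L, IsVariety K → SubClass C K → K M iM

/-- The class of isomorphic copies of a single structure. -/
def ClassOf (A : Type u) [iA : L.Structure A] : StructClass L :=
  fun M iM => Nonempty (@FirstOrder.Language.Equiv L M A iM iA)

/-- A class is nontrivial when it has a member with at least two elements. -/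
def NontrivialClass (K : StructClass L) : Prop :=
  ∃ (M : Type u) (iM : L.Structure M), K M iM ∧ Nontrivial M

/-- The joint embedding property. -/
def HasJEP (K : StructClass L) : Prop :=
  ∀ (A : Type u) [iA : L.Structure A] (B : Type u) [iB : L.Structure B],
    K A iA → K B iB → Nontrivial A → Nontrivial B →
    ∃ (C : Type u) (iC : L.Structure C), K C iC ∧
      Nonempty (@FirstOrder.Language.Embedding L A C iA iC) ∧
      Nonempty (@FirstOrder.Language.Embedding L B C iB iC)

/-- There is a homomorphism from `A` into some ultrapower of `B`. -/
def MapsIntoUltrapower (L : FirstOrder.Language.{u, u}) (A B : Type u)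
    [iA : L.Structure A] [iB : L.Structure B] : Prop :=
  ∃ (ι : Type u) (uf : Ultrafilter ι),
    Nonempty (A →[L] ((uf : Filter ι).Product fun _ : ι => B))

/-- There is an embedding of `A` into some ultrapower of `B`. -/
def EmbedsIntoUltrapower (L : FirstOrder.Language.{u, u}) (A B : Type u)
    [iA : L.Structure A] [iB : L.Structure B] : Prop :=
  ∃ (ι : Type u) (uf : Ultrafilter ι),
    Nonempty (A ↪[L] ((uf : Filter ι).Product fun _ : ι => B))

/-- Passive structural completeness: all nontrivial members satisfy the same
existential positive sentences. -/
def IsPSC (K : StructClass L) : Prop :=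
  ∀ (A : Type u) [iA : L.Structure A] (B : Type u) [iB : L.Structure B],
    K A iA → K B iB → Nontrivial A → Nontrivial B →
    ∀ φ : L.Sentence, IsEP φ → (A ⊨ φ → B ⊨ φ)

/-- A relatively simple (K-simple) member of `K`. -/
def RelSimple (K : StructClass L) (A : Type u) [iA : L.Structure A] : Prop :=
  K A iA ∧ Nontrivial A ∧
    ∀ (B : Type u) [iB : L.Structure B], K B iB → Nontrivial B →
      ∀ h : A →[L] B, Function.Surjective h → Function.Injective h

/-- The class of relatively simple members of `K`. -/
def RelSimpleClass (K : StructClass L) : StructClass L :=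
  fun A iA => @RelSimple L K A iA

/-- A relatively subdirectly irreducible member of `K`. -/
def RelSDI (K : StructClass L) (A : Type u) [iA : L.Structure A] : Prop :=
  K A iA ∧
    ∀ (ι : Type u) (M : ι → Type u) [iM : ∀ i, L.Structure (M i)],
      (∀ i, K (M i) (iM i)) →
      ∀ h : @FirstOrder.Language.Embedding L A (∀ i, M i) iA (piStructure M),
        (∀ i, Function.Surjective fun a => h a i) →
        ∃ i, Function.Bijective fun a => h a i

/-- The class of relatively subdirectly irreducible members of `K`. -/
def RelSDIClass (K : StructClass L) : StructClass L :=
  fun A iA => @RelSDI L K A iA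

/-- `K` is relatively semisimple. -/
def RelSemisimple (K : StructClass L) : Prop :=
  ∀ (M : Type u) [iM : L.Structure M], K M iM → RelSDI K M → RelSimple K M

/-- A congruence of a structure. -/
def IsCong (L : FirstOrder.Language.{u, u}) (A : Type u) [iA : L.Structure A] (θ : Setoid A) : Prop :=
  (∀ (n : ℕ) (f : L.Functions n) (x y : Fin n → A),
      (∀ i, θ.r (x i) (y i)) → θ.r (funMap f x) (funMap f y)) ∧
  (∀ (n : ℕ) (r : L.Relations n) (x y : Fin n → A),
      (∀ i, θ.r (x i) (y i)) → (RelMap r x ↔ RelMap r y))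

/-- The prestructure determined by a congruence. -/
def congPrestructure (L : FirstOrder.Language.{u, u}) (A : Type u) [iA : L.Structure A]
    (θ : Setoid A) (h : IsCong L A θ) : L.Prestructure θ where
  toStructure := iA
  fun_equiv := fun x y hxy => h.1 _ _ x y fun i => hxy i
  rel_equiv := fun x y hxy => propext (h.2 _ _ x y fun i => hxy i)

/-- The quotient structure by a congruence. -/
def quotStructure (L : FirstOrder.Language.{u, u}) (A : Type u) [iA : L.Structure A]
    (θ : Setoid A) (h : IsCong L A θ) : L.Structure (Quotient θ) :=
  @FirstOrder.Language.quotientStructure L A θ (congPrestructure L A θ h)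

/-- A `K`-congruence (relative congruence) of `A`. -/
def IsKCong (K : StructClass L) (A : Type u) [iA : L.Structure A] (θ : Setoid A) : Prop :=
  ∃ h : IsCong L A θ, K (Quotient θ) (quotStructure L A θ h)

/-- The total relation `A × A` is a compact element of the lattice of
`K`-congruences of `A`. -/
def TopKCompact (K : StructClass L) (A : Type u) [iA : L.Structure A] : Prop :=
  ∀ S : Set (Setoid A), (∀ θ ∈ S, IsKCong K A θ) →
    (∀ θ : Setoid A, IsKCong K A θ → (∀ σ ∈ S, σ ≤ θ) → θ = ⊤) →
    ∃ S₀ : Set (Setoid A), S₀ ⊆ S ∧ S₀.Finite ∧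
      ∀ θ : Setoid A, IsKCong K A θ → (∀ σ ∈ S₀, σ ≤ θ) → θ = ⊤

/-- `A` has a homomorphic image in `K` that is `K`-simple. -/
def HasRelSimpleImage (K : StructClass L) (A : Type u) [iA : L.Structure A] : Prop :=
  ∃ (B : Type u) (iB : L.Structure B), K B iB ∧
    (∃ h : @FirstOrder.Language.Hom L A B iA iB, Function.Surjective h) ∧
    @RelSimple L K B iB

/-- The language has finitely many operation and relation symbols. -/
def FiniteType (L : FirstOrder.Language.{u, u}) : Prop :=
  Finite (Σ n, L.Functions n) ∧ Finite (Σ n, L.Relations n)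

/-- An algebra is `0`-generated when it is generated by the empty set. -/
def ZeroGen (L : FirstOrder.Language.{u, u}) (A : Type u) [iA : L.Structure A] : Prop :=
  Substructure.closure L (∅ : Set A) = ⊤

/-- `A` has a one-element (trivial) subalgebra. -/
def HasOneElemSub (L : FirstOrder.Language.{u, u}) (A : Type u) [iA : L.Structure A] : Prop :=
  ∃ c : A, ∀ (n : ℕ) (f : L.Functions n), funMap f (fun _ => c) = c

/-- A Kollár class: nontrivial members have no trivial subalgebra. -/
def IsKollar (K : StructClass L) : Prop :=
  ∀ (M : Type u) [iM : L.Structure M], K M iM → Nontrivial M → ¬ HasOneElemSub L M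

/-- `A` is a retract of `B`. -/
def IsRetractOf (L : FirstOrder.Language.{u, u}) (A B : Type u)
    [iA : L.Structure A] [iB : L.Structure B] : Prop :=
  ∃ (g : A →[L] B) (h : B →[L] A), ∀ a : A, h (g a) = a

/-- Validity of an equation in a class. -/
def EqValid (K : StructClass L) (t₁ t₂ : L.Term ℕ) : Prop :=
  ∀ (M : Type u) [iM : L.Structure M], K M iM →
    ∀ v : ℕ → M, t₁.realize v = t₂.realize v

/-- Validity of a quasi-equation (with premise set `Γ`) in a class. -/
def QEqValid (K : StructClass L) (Γ : Set (L.Term ℕ × L.Term ℕ))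
    (t₁ t₂ : L.Term ℕ) : Prop :=
  ∀ (M : Type u) [iM : L.Structure M], K M iM → ∀ v : ℕ → M,
    (∀ p ∈ Γ, Term.realize v p.1 = Term.realize v p.2) →
    t₁.realize v = t₂.realize v

/-- A set of equations is unifiable over `K`. -/
def Unifiable (K : StructClass L) (Γ : Set (L.Term ℕ × L.Term ℕ)) : Prop :=
  ∃ h : ℕ → L.Term ℕ, ∀ p ∈ Γ, EqValid K (p.1.subst h) (p.2.subst h)

/-- No quasi-equation is passive over `K`: every finite set of equations is
unifiable over `K`. -/
def NoPassiveQEq (K : StructClass L) : Prop :=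
  ∀ Γ : Set (L.Term ℕ × L.Term ℕ), Γ.Finite → Unifiable K Γ

/-- The set of variables occurring in a set of equations. -/
def EqnsVars (Γ : Set (L.Term ℕ × L.Term ℕ)) : Set ℕ :=
  ⋃ p ∈ Γ, (↑(p.1.varFinset ∪ p.2.varFinset) : Set ℕ)

/-- `F` is a free `1`-generated algebra for `K`, with free generator `x`. -/
def IsFreeOne (K : StructClass L) (F : Type u) [iF : L.Structure F] (x : F) : Prop :=
  K F iF ∧ Substructure.closure L ({x} : Set F) = ⊤ ∧
    ∀ (M : Type u) [iM : L.Structure M], K M iM → ∀ m : M,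
      ∃ h : F →[L] M, h x = m

/-- A minimal quasivariety. -/
def MinimalQV (K : StructClass L) : Prop :=
  NontrivialClass K ∧ ∀ K' : StructClass L, IsQuasivariety K' → SubClass K' K →
    NontrivialClass K' → EqClass K' K

/-- A trivial class: all members have at most one element. -/
def TrivialClass (K : StructClass L) : Prop :=
  ∀ (M : Type u) [iM : L.Structure M], K M iM → Subsingleton M

/-- The congruence of `A` generated by the pair `(a, b)`. -/
def congGen (L : FirstOrder.Language.{u, u}) (A : Type u) [iA : L.Structure A] (a b : A) : Setoid A :=
  sInf {θ : Setoid A | IsCong L A θ ∧ θ.r a b}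

/-- Equationally definable principal congruences. -/
def HasEDPC (K : StructClass L) : Prop :=
  ∃ S : Finset (L.Term (Fin 4) × L.Term (Fin 4)),
    ∀ (M : Type u) [iM : L.Structure M], K M iM → ∀ a b c d : M,
      ((congGen L M a b).r c d ↔
        ∀ p ∈ S, Term.realize ![a, b, c, d] p.1 = Term.realize ![a, b, c, d] p.2)

/-- A simple algebra: nontrivial, and its only congruences are the identity
and the total relation. -/
def IsSimpleAlg (L : FirstOrder.Language.{u, u}) (A : Type u) [iA : L.Structure A] : Prop :=
  Nontrivial A ∧ ∀ θ : Setoid A, IsCong L A θ → θ = ⊥ ∨ θ = ⊤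

/-- Structural completeness: every subquasivariety generating the same variety
coincides with the class itself. -/
def IsSC (K : StructClass L) : Prop :=
  ∀ K' : StructClass L, IsQuasivariety K' → SubClass K' K →
    EqClass (VGen K') (VGen K) → EqClass K' K


/-- The positive atomic facts true in `A`: graph points of operations, and instances of relations. -/
abbrev AtomicFact (L : FirstOrder.Language.{u, u}) (A : Type u) [L.Structure A] : Type u :=
  (Σ n, L.Functions n × (Fin n → A)) ⊕ {r : Σ n, L.Relations n × (Fin n → A) // RelMap r.2.1 r.2.2}

/-- The elements of `A` mentioned by an atomic fact. -/
def AtomicFact.support {A : Type u} [L.Structure A] : AtomicFact L A → Set A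
  | .inl f => insert (funMap f.2.1 f.2.2) (Set.range f.2.2)
  | .inr r => Set.range r.1.2.2

/-- The map `g` transports the given atomic fact of `A` to an atomic fact of `B`. -/
def AtomicFact.PreservedBy {A B : Type u} [L.Structure A] [L.Structure B] (g : A → B) :
    AtomicFact L A → Prop
  | .inl f => funMap f.2.1 (fun i => g (f.2.2 i)) = g (funMap f.2.1 f.2.2)
  | .inr r => RelMap r.1.2.1 fun i => g (r.1.2.2 i)

lemma AtomicFact.finite_support {A : Type u} [L.Structure A] (f : AtomicFact L A) :
    f.support.Finite := by
  rcases f with f | r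
  · exact (Set.finite_range _).insert _
  · exact Set.finite_range _

lemma AtomicFact.preservedBy_of_eqOn {A : Type u} [L.Structure A] (f : AtomicFact L A) {g : A → A}
    (hg : ∀ a ∈ f.support, g a = a) : f.PreservedBy g := by
  rcases f with ⟨n, f, x⟩ | ⟨⟨n, r, x⟩, hr⟩
  · have hx : (fun i => g (x i)) = x :=
      funext fun i => hg _ (Set.mem_insert_of_mem _ (Set.mem_range_self i))
    have hy : g (funMap f x) = funMap f x := hg _ (Set.mem_insert _ _)
    change funMap f (fun i => g (x i)) = g (funMap f x)
    rw [hx, hy]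
  · have hx : (fun i => g (x i)) = x := funext fun i => hg _ (Set.mem_range_self i)
    change RelMap r fun i => g (x i)
    rw [hx]
    exact hr

lemma AtomicFact.exists_isEP {A : Type u} [L.Structure A] {n : ℕ} (idx : A → Fin n)
    (f : AtomicFact L A) :
    ∃ φ : L.BoundedFormula Empty n, IsEP φ ∧
      ∀ (M : Type u) [L.Structure M] (y : Fin n → M),
        φ.Realize default y ↔ f.PreservedBy (y ∘ idx) := by
  rcases f with ⟨k, f, x⟩ | ⟨⟨k, r, x⟩, hr⟩
  · refine ⟨_, IsEP.equal (Term.func f fun i => Term.var (Sum.inr (idx (x i))))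
      (Term.var (Sum.inr (idx (funMap f x)))), fun M _ y => ?_⟩
    simp [AtomicFact.PreservedBy]
  · refine ⟨_, IsEP.rel r fun i => Term.var (Sum.inr (idx (x i))), fun M _ y => ?_⟩
    exact BoundedFormula.realize_rel

lemma exists_isEP_conj {A : Type u} [L.Structure A] {n : ℕ} [NeZero n] (idx : A → Fin n)
    (S : Finset (AtomicFact L A)) :
    ∃ φ : L.BoundedFormula Empty n, IsEP φ ∧
      ∀ (M : Type u) [L.Structure M] (y : Fin n → M),
        φ.Realize default y ↔ ∀ f ∈ S, f.PreservedBy (y ∘ idx) := by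
  classical
  induction S using Finset.induction_on with
  | empty =>
    exact ⟨_, IsEP.equal (Term.var (Sum.inr 0)) (Term.var (Sum.inr 0)), fun M _ y => by simp⟩
  | insert f S _ ih =>
    obtain ⟨φ, hφ, hφ'⟩ := ih
    obtain ⟨ψ, hψ, hψ'⟩ := f.exists_isEP idx
    exact ⟨_, hψ.inf hφ, fun M _ y => by simp [hφ', hψ']⟩

lemma IsEP.exs : ∀ {n : ℕ} {φ : L.BoundedFormula Empty n}, IsEP φ → IsEP φ.exs
  | 0, _, h => h
  | _ + 1, φ, h => IsEP.exs (φ := φ.ex) h.ex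

/-- If `B` satisfies every existential positive sentence true in `A`, then finitely many atomic
facts of `A` can be transported to `B`. -/
lemma exists_preservedBy_of_isEP {A B : Type u} [L.Structure A] [L.Structure B] [Nonempty A]
    (hAB : ∀ φ : L.Sentence, IsEP φ → A ⊨ φ → B ⊨ φ) (S : Finset (AtomicFact L A)) :
    ∃ g : A → B, ∀ f ∈ S, f.PreservedBy g := by
  classical
  obtain ⟨a₀⟩ := ‹Nonempty A›
  have hfin : (insert a₀ (⋃ f ∈ S, f.support)).Finite :=
    (S.finite_toSet.biUnion fun f _ => f.finite_support).insert a₀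
  obtain ⟨n, e, he⟩ := hfin.fin_embedding
  have hn : Nonempty (Fin n) := by
    obtain ⟨i, -⟩ : a₀ ∈ Set.range e := he ▸ Set.mem_insert _ _
    exact ⟨i⟩
  have : NeZero n := ⟨fun h => by subst h; exact hn.elim Fin.elim0⟩
  obtain ⟨φ, hφ, hφ'⟩ := exists_isEP_conj (Function.invFun e) S
  have hA : A ⊨ φ.exs := by
    refine BoundedFormula.realize_exs.2 ⟨e, (hφ' A e).2 fun f hf =>
      f.preservedBy_of_eqOn fun a ha => Function.invFun_eq ?_⟩
    change a ∈ Set.range e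
    rw [he]
    exact Set.mem_insert_of_mem _ (Set.mem_biUnion hf ha)
  obtain ⟨y, hy⟩ := BoundedFormula.realize_exs.1 (hAB _ hφ.exs hA)
  exact ⟨_, (hφ' B y).1 hy⟩

lemma Ultraproduct.relMap_cast {ι : Type u} {M : ι → Type u} [∀ i, L.Structure (M i)]
    {uf : Ultrafilter ι} {n : ℕ} (r : L.Relations n) (x : Fin n → ∀ i, M i) :
    (RelMap r fun i => (x i : (uf : Filter ι).Product M)) ↔
      ∀ᶠ a in uf, RelMap r fun i => x i a :=
  relMap_quotient_mk' _ r x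

lemma mapsIntoUltrapower_of_isEP {A B : Type u} [L.Structure A] [L.Structure B] [Nonempty A]
    (hAB : ∀ φ : L.Sentence, IsEP φ → A ⊨ φ → B ⊨ φ) : MapsIntoUltrapower L A B := by
  classical
  choose g hg using exists_preservedBy_of_isEP hAB
  let uf : Ultrafilter (Finset (AtomicFact L A)) := Ultrafilter.of Filter.atTop
  have huf (f : AtomicFact L A) : ∀ᶠ S in uf, f.PreservedBy (g S) := by
    refine Ultrafilter.of_le Filter.atTop ?_
    filter_upwards [Filter.eventually_ge_atTop {f}] with S hS
    exact hg S f (hS (Finset.mem_singleton_self f))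
  refine ⟨_, uf, ⟨⟨fun a => ((fun S => g S a : Finset (AtomicFact L A) → B) :
    (uf : Filter (Finset (AtomicFact L A))).Product fun _ => B), fun {n} f x => ?_,
    fun {n} r x hr => ?_⟩⟩⟩
  · refine Eq.trans (Quotient.sound ?_) (Ultraproduct.funMap_cast f fun i S => g S (x i)).symm
    exact (huf (.inl ⟨n, f, x⟩)).mono fun S hS => hS.symm
  · exact (Ultraproduct.relMap_cast r fun i S => g S (x i)).2 (huf (.inr ⟨⟨n, r, x⟩, hr⟩))

/-- The diagonal embedding of a structure into an ultrapower. -/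
def diagonalEmbedding {A : Type u} [L.Structure A] {ι : Type u} (uf : Ultrafilter ι) :
    A ↪[L] (uf : Filter ι).Product fun _ : ι => A where
  toFun a := ((fun _ => a : ι → A) : (uf : Filter ι).Product fun _ => A)
  inj' a b h := by
    have : ∀ᶠ _ in (uf : Filter ι), a = b := Quotient.exact (s := Filter.productSetoid _ _) h
    exact this.exists.choose_spec
  map_fun' f x := (Ultraproduct.funMap_cast f fun i _ => x i).symm
  map_rel' r x := (Ultraproduct.relMap_cast r fun i _ => x i).trans Filter.eventually_const

/-- A family of homomorphisms, one of which is an embedding, embeds a structure in a product. -/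
lemma nonempty_embedding_pi {A ι : Type u} [L.Structure A] {M : ι → Type u}
    [iM : ∀ i, L.Structure (M i)] (f : ∀ i, A →[L] M i) (j : ι) (e : A ↪[L] M j)
    (he : ∀ a, f j a = e a) :
    let _ := piStructure (L := L) M
    Nonempty (A ↪[L] ∀ i, M i) := by
  let _ := piStructure (L := L) M
  refine ⟨⟨⟨fun a i => f i a, fun a b h => e.injective ?_⟩, fun F x => ?_, fun R x => ?_⟩⟩
  · rw [← he, ← he]
    exact congrFun h j
  · exact funext fun i => (f i).map_fun F x
  · refine ⟨fun h => ?_, fun h i => (f i).map_rel R x h⟩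
    refine (e.map_rel R x).1 ?_
    have hj : RelMap R (f j ∘ x) := h j
    rwa [show f j ∘ x = e ∘ x from funext fun k => he (x k)] at hj

lemma HasJEP.of_isPSC {K : StructClass L} (hK : IsQuasivariety K) (hpsc : IsPSC K) :
    HasJEP K := by
  intro A iA B iB hA hB ntA ntB
  obtain ⟨ι, uf, ⟨h⟩⟩ := mapsIntoUltrapower_of_isEP (hpsc A B hA hB ntA ntB)
  obtain ⟨κ, vf, ⟨g⟩⟩ := mapsIntoUltrapower_of_isEP (hpsc B A hB hA ntB ntA)
  let M : ULift.{u} Bool → Type u := fun b =>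
    Bool.rec ((vf : Filter κ).Product fun _ => A) ((uf : Filter ι).Product fun _ => B) b.down
  let iM : ∀ b, L.Structure (M b)
    | ⟨false⟩ => inferInstanceAs (L.Structure ((vf : Filter κ).Product fun _ => A))
    | ⟨true⟩ => inferInstanceAs (L.Structure ((uf : Filter ι).Product fun _ => B))
  have hM : ∀ b, K (M b) (iM b)
    | ⟨false⟩ => hK.ultra_closed κ (fun _ => A) vf fun _ => hA
    | ⟨true⟩ => hK.ultra_closed ι (fun _ => B) uf fun _ => hB
  let fA : ∀ b, @Hom L A (M b) iA (iM b)
    | ⟨false⟩ => (diagonalEmbedding vf).toHom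
    | ⟨true⟩ => h
  let fB : ∀ b, @Hom L B (M b) iB (iM b)
    | ⟨false⟩ => g
    | ⟨true⟩ => (diagonalEmbedding uf).toHom
  exact ⟨∀ b, M b, @piStructure L _ M iM, hK.prod_closed _ M (iM := iM) hM,
    nonempty_embedding_pi (iM := iM) fA ⟨false⟩ (diagonalEmbedding vf) fun _ => rfl,
    nonempty_embedding_pi (iM := iM) fB ⟨true⟩ (diagonalEmbedding uf) fun _ => rfl⟩

/-- a PSC quasivariety has the JEP, as does every
subquasivariety of it. -/
theorem statement_2 (L : FirstOrder.Language.{u, u}) (K : StructClass L)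
    (hK : IsQuasivariety K) (hpsc : IsPSC K) :
    HasJEP K ∧
      ∀ K' : StructClass L, IsQuasivariety K' → SubClass K' K → HasJEP K' :=
  ⟨.of_isPSC hK hpsc, fun _ hK' hsub => .of_isPSC hK' fun A _ B _ hA hB =>
    hpsc A B (hsub _ _ hA) (hsub _ _ hB)⟩

end Paper
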